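/- arXiv:1005.4810 — 4 statements merged into one kernel-verified Lean document; each statement's English description precedes it below -/
import Mathlib

section
/- There exists a continuous map μ : S² → S²×S² whose image is contained in the wedge W = (S² × {p}) ∪ ({p} × S²), with μ(p) = (p,p), such that the diagonal map Δ(x) = (x,x) is homotopic to μ rel the basepoint {p}. -/
noncomputable section

/-- The 2-sphere as the unit sphere in `EuclideanSpace ℝ (Fin 3)`. -/
abbrev Sph : Type := Metric.sphere (0 : EuclideanSpace ℝ (Fin 3)) 1

/-- `X = S² × S²`. -/
abbrev Xt : Type := Sph × Sph

/-- The diagonal map `Δ : S² → S² × S²` as a continuous map. -/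
def diagC : C(Sph, Xt) := ⟨fun x => (x, x), by fun_prop⟩

/-- The wedge `W = (S² × {p}) ∪ ({p} × S²)` of the two coordinate spheres. -/
def wedge (p : Sph) : Set Xt := (Set.univ ×ˢ {p}) ∪ ({p} ×ˢ Set.univ)

open scoped RealInnerProductSpace

theorem no_zero_of_inner_equations {t m u h : ℝ} (ht₀ : 0 ≤ t) (ht₁ : t ≤ 1) (hm₀ : 0 ≤ m)
    (hum : u ≤ m)
    (hp : (1 - t + t * m) * h + t / 4 = 0)
    (he : (1 - t + t * m) * (u - t / 2 * (1 - h)) = 0)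
    (hx : (1 - t + t * m) * (1 - t / 2 * (1 - h) * u) + t / 4 * h = 0) : False := by
  have ha₀ : 0 ≤ 1 - t + t * m := by nlinarith [mul_nonneg ht₀ hm₀]
  obtain ha | ha := ha₀.eq_or_lt
  · have ht : t = 0 := by rw [← ha] at hp; linarith
    simp [ht] at ha
  have hu : u = t / 2 * (1 - h) := by
    rcases mul_eq_zero.1 he with h' | h' <;> linarith
  have hs : u ^ 2 + h ^ 2 = 1 := by
    refine mul_left_cancel₀ ha.ne' ?_
    rw [← hu] at hx
    linear_combination h * hp - hx
  have hh : h ≤ 0 := by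
    by_contra! hh
    nlinarith [mul_pos ha hh]
  have ht : 1 + h = t ^ 2 / 4 * (1 - h) := by
    refine mul_left_cancel₀ (show 1 - h ≠ 0 by linarith) ?_
    rw [hu] at hs
    linear_combination -hs
  have hh' : h ≤ -3 / 5 := by nlinarith
  have hu' : t * (4 / 5) ≤ u := by nlinarith
  have ham : 1 - t + t * (t * (4 / 5)) ≤ 1 - t + t * m := by
    gcongr
    exact hu'.trans hum
  nlinarith [sq_nonneg (t - 5 / 8)]

section Push

variable {E : Type*} [NormedAddCommGroup E] [InnerProductSpace ℝ E]

theorem exists_unit_orthogonal [FiniteDimensional ℝ E] (hE : 1 < Module.finrank ℝ E) (p : E) :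
    ∃ e : E, ‖e‖ = 1 ∧ ⟪p, e⟫ = 0 := by
  have hne : (ℝ ∙ p)ᗮ ≠ ⊥ := by
    intro h
    rw [Submodule.orthogonal_eq_bot_iff] at h
    have := finrank_span_le_card (R := ℝ) ({p} : Set E)
    rw [h, finrank_top, Set.toFinset_card, Fintype.card_unique] at this
    omega
  obtain ⟨v, hv, hv₀⟩ := Submodule.exists_mem_ne_zero_of_ne_bot hne
  refine ⟨NormedSpace.normalize v, NormedSpace.norm_normalize_eq_one_iff.2 hv₀, ?_⟩
  rw [NormedSpace.normalize, real_inner_smul_right,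
    Submodule.mem_orthogonal_singleton_iff_inner_right.1 hv, mul_zero]

/-- For orthogonal unit vectors `p` and `e`, this deforms the unit sphere from the identity at
`t = 0` to a map that, up to normalization, sends the hemisphere `⟪x, e⟫ ≤ 0` to `p` at `t = 1`. -/
def pushVec (p e : E) (t : ℝ) (x : E) : E :=
  (1 - t + t * max ⟪x, e⟫ 0) • (x - (t / 2 * (1 - ⟪x, p⟫)) • e) + (t / 4) • p

theorem continuous_pushVec (p e : E) : Continuous fun y : ℝ × E => pushVec p e y.1 y.2 := by
  unfold pushVec
  fun_prop

theorem pushVec_zero (p e x : E) : pushVec p e 0 x = x := by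
  simp [pushVec]

theorem pushVec_one {p e x : E} (hx : ⟪x, e⟫ ≤ 0) : pushVec p e 1 x = (1 / 4 : ℝ) • p := by
  simp [pushVec, max_eq_right hx]

theorem pushVec_basepoint {p e : E} (hp : ‖p‖ = 1) (hpe : ⟪p, e⟫ = 0) (t : ℝ) :
    pushVec p e t p = (1 - t + t / 4) • p := by
  simp [pushVec, hpe, hp, add_smul]

theorem pushVec_ne_zero {p e x : E} (hp : ‖p‖ = 1) (he : ‖e‖ = 1) (hpe : ⟪p, e⟫ = 0)
    (hx : ‖x‖ = 1) {t : ℝ} (ht₀ : 0 ≤ t) (ht₁ : t ≤ 1) : pushVec p e t x ≠ 0 := by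
  intro hv
  have hep : ⟪e, p⟫ = 0 := by rw [real_inner_comm, hpe]
  have hvp : ⟪pushVec p e t x, p⟫ = 0 := by rw [hv, inner_zero_left]
  have hve : ⟪pushVec p e t x, e⟫ = 0 := by rw [hv, inner_zero_left]
  have hvx : ⟪pushVec p e t x, x⟫ = 0 := by rw [hv, inner_zero_left]
  simp only [pushVec, inner_add_left, inner_sub_left, real_inner_smul_left,
    real_inner_self_eq_norm_sq, hp, he, hx, hpe, hep, real_inner_comm x p,
    real_inner_comm x e] at hvp hve hvx
  exact no_zero_of_inner_equations (u := ⟪x, e⟫) (h := ⟪x, p⟫) ht₀ ht₁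
    (le_max_right _ _) (le_max_left _ _)
    (by linear_combination hvp) (by linear_combination hve) (by linear_combination hvx)

/-- The deformation `pushVec`, normalized to a map into the unit sphere. -/
def push {p e : E} (hp : ‖p‖ = 1) (he : ‖e‖ = 1) (hpe : ⟪p, e⟫ = 0) :
    C(unitInterval × Metric.sphere (0 : E) 1, Metric.sphere (0 : E) 1) where
  toFun y := ⟨NormedSpace.normalize (pushVec p e y.1 y.2), by
    rw [mem_sphere_zero_iff_norm, NormedSpace.norm_normalize_eq_one_iff]
    exact pushVec_ne_zero hp he hpe (norm_eq_of_mem_sphere y.2) y.1.2.1 y.1.2.2⟩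
  continuous_toFun := by
    have hc : Continuous fun y : unitInterval × Metric.sphere (0 : E) 1 =>
        pushVec p e y.1 y.2 :=
      (continuous_pushVec p e).comp (by fun_prop : Continuous
        fun y : unitInterval × Metric.sphere (0 : E) 1 => ((y.1 : ℝ), (y.2 : E)))
    refine ((hc.norm.inv₀ fun y => ?_).smul hc).subtype_mk _
    exact norm_ne_zero_iff.2
      (pushVec_ne_zero hp he hpe (norm_eq_of_mem_sphere y.2) y.1.2.1 y.1.2.2)

variable {p : Metric.sphere (0 : E) 1} {e : E} (hp : ‖(p : E)‖ = 1) (he : ‖e‖ = 1)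
  (hpe : ⟪(p : E), e⟫ = 0)

theorem coe_push (t : unitInterval) (x : Metric.sphere (0 : E) 1) :
    (push hp he hpe (t, x) : E) = NormedSpace.normalize (pushVec (p : E) e t x) :=
  rfl

theorem push_zero (x : Metric.sphere (0 : E) 1) : push hp he hpe (0, x) = x := by
  ext1
  rw [coe_push, Set.Icc.coe_zero, pushVec_zero,
    NormedSpace.normalize_eq_self_of_norm_eq_one (norm_eq_of_mem_sphere x)]

theorem push_one {x : Metric.sphere (0 : E) 1} (hx : ⟪(x : E), e⟫ ≤ 0) :
    push hp he hpe (1, x) = p := by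
  ext1
  rw [coe_push, Set.Icc.coe_one, pushVec_one hx,
    NormedSpace.normalize_smul_of_pos (by norm_num),
    NormedSpace.normalize_eq_self_of_norm_eq_one hp]

theorem push_basepoint (t : unitInterval) : push hp he hpe (t, p) = p := by
  ext1
  have ht := t.2.2
  rw [coe_push, pushVec_basepoint hp hpe,
    NormedSpace.normalize_smul_of_pos (by linarith [t.2.1]),
    NormedSpace.normalize_eq_self_of_norm_eq_one hp]

end Push

/-- There is a continuous map `μ : S² → S² × S²` with image in the wedge
`W = (S² × {p}) ∪ ({p} × S²)`, sending `p` to `(p,p)`, such that the diagonal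
map is homotopic to `μ` rel the basepoint `{p}`. -/
theorem diagonal_homotopic_to_wedge_map (p : Sph) :
    ∃ μ : C(Sph, Xt), Set.range μ ⊆ wedge p ∧ μ p = (p, p) ∧
      Nonempty (diagC.HomotopyRel μ {p}) := by
  have hp : ‖(p : EuclideanSpace ℝ (Fin 3))‖ = 1 := norm_eq_of_mem_sphere p
  obtain ⟨e, he, hpe⟩ := exists_unit_orthogonal (by simp) (p : EuclideanSpace ℝ (Fin 3))
  have he' : ‖-e‖ = 1 := by rwa [norm_neg]
  have hpe' : ⟪(p : EuclideanSpace ℝ (Fin 3)), -e⟫ = 0 := by rw [inner_neg_right, hpe, neg_zero]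
  let H : C(unitInterval × Sph, Xt) := (push hp he hpe).prodMk (push hp he' hpe')
  refine ⟨H.comp ((ContinuousMap.const _ 1).prodMk (ContinuousMap.id _)), ?_, ?_,
    ⟨⟨⟨H, fun x => ?_, fun x => rfl⟩, ?_⟩⟩⟩
  · rintro _ ⟨x, rfl⟩
    rcases le_total ⟪(x : EuclideanSpace ℝ (Fin 3)), e⟫ 0 with hx | hx
    · exact Or.inr ⟨push_one hp he hpe hx, trivial⟩
    · exact Or.inl ⟨trivial, push_one hp he' hpe' (by rwa [inner_neg_right, neg_nonpos])⟩
  · exact Prod.ext (push_basepoint hp he hpe 1) (push_basepoint hp he' hpe' 1)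
  · exact Prod.ext (push_zero hp he hpe x) (push_zero hp he' hpe' x)
  · rintro t _ rfl
    exact Prod.ext (push_basepoint hp he hpe t) (push_basepoint hp he' hpe' t)
end
end

section
/- The four self-maps of X = S²×S² fixing the diagonal given by I(x,y) = (x,y), T(x,y) = (y,x), P'(x,y) = (x,x), and P''(x,y) = (y,y) are pairwise non-homotopic rel the diagonal D; that is, no two distinct maps among I, T, P', P'' are homotopic rel D. -/
noncomputable section

/-- The diagonal map `Δ : S² → S² × S²`. -/
def diagMap : Sph → Xt := fun x => (x, x)

/-- The diagonal `D ⊆ S² × S²`. -/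
def Ddiag : Set Xt := Set.range diagMap

/-- The identity `I(x,y) = (x,y)`. -/
def Imap : C(Xt, Xt) := ContinuousMap.id Xt

/-- The interchange map `T(x,y) = (y,x)`. -/
def Tmap : C(Xt, Xt) := ⟨fun z => (z.2, z.1), by fun_prop⟩

/-- The map `P'(x,y) = (x,x)`. -/
def P1map : C(Xt, Xt) := ⟨fun z => (z.1, z.1), by fun_prop⟩

/-- The map `P''(x,y) = (y,y)`. -/
def P2map : C(Xt, Xt) := ⟨fun z => (z.2, z.2), by fun_prop⟩

/-- There is a continuous nowhere vanishing `v : X → E` with `v x` orthogonal to `f x` for all `x`,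
that is, a nowhere vanishing section of the pullback of the tangent bundle of the sphere. -/
def AdmitsTangentField {X E : Type*} [TopologicalSpace X] [NormedAddCommGroup E]
    [InnerProductSpace ℝ E] (f : X → Metric.sphere (0 : E) 1) : Prop :=
  ∃ v : X → E, Continuous v ∧ ∀ x, v x ≠ 0 ∧ inner ℝ (v x) (f x : E) = 0

theorem AdmitsTangentField.of_inner_ne_zero {X E : Type*} [TopologicalSpace X]
    [NormedAddCommGroup E] [InnerProductSpace ℝ E] {f g : X → Metric.sphere (0 : E) 1}
    (hf : AdmitsTangentField f) (hg : Continuous g)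
    (hfg : ∀ x, inner ℝ (g x : E) (f x : E) ≠ 0) : AdmitsTangentField g := by
  obtain ⟨v, hv, hvf⟩ := hf
  refine ⟨fun x ↦ v x - inner ℝ (v x) (g x : E) • (g x : E), by fun_prop, fun x ↦ ⟨fun h ↦ ?_, ?_⟩⟩
  · have h1 : v x = inner ℝ (v x) (g x : E) • (g x : E) := sub_eq_zero.mp h
    have h2 := (hvf x).2
    rw [h1, inner_smul_left, mul_eq_zero, or_iff_left (hfg x)] at h2
    have h3 : inner ℝ (v x) (g x : E) = 0 := by simpa using h2
    rw [h3, zero_smul] at h1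
    exact (hvf x).1 h1
  · have : ‖(g x : E)‖ = 1 := by simp
    simp [inner_sub_left, inner_smul_left, this]

theorem AdmitsTangentField.of_homotopic {X E : Type*} [TopologicalSpace X] [CompactSpace X]
    [NormedAddCommGroup E] [InnerProductSpace ℝ E] {f g : C(X, Metric.sphere (0 : E) 1)}
    (hf : AdmitsTangentField f) (hfg : f.Homotopic g) : AdmitsTangentField g := by
  obtain ⟨H⟩ := hfg
  have key : IsLocallyConstant fun t : unitInterval ↦ AdmitsTangentField fun x ↦ H (t, x) := by
    rw [IsLocallyConstant.iff_eventually_eq]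
    intro t
    have hev : ∀ᶠ s in nhds t, ∀ x ∈ (Set.univ : Set X),
        inner ℝ (H (s, x) : E) (H (t, x) : E) ≠ 0 := by
      refine isCompact_univ.eventually_forall_of_forall_eventually fun y _ ↦ ?_
      have hc : Continuous fun z : unitInterval × X ↦
          inner ℝ (H (z.1, z.2) : E) (H (t, z.2) : E) := by
        have hH := H.continuous
        fun_prop
      exact hc.continuousAt.eventually_ne (by simp)
    filter_upwards [hev] with s hs
    refine propext ⟨fun h ↦ h.of_inner_ne_zero (by fun_prop) fun x ↦ ?_,
      fun h ↦ h.of_inner_ne_zero (by fun_prop) fun x ↦ hs x trivial⟩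
    rw [real_inner_comm]
    exact hs x trivial
  have h01 := key.apply_eq_of_preconnectedSpace 0 1
  simp only [H.apply_zero, H.apply_one, eq_iff_iff] at h01
  exact h01.mp hf

theorem eq_of_exp_comp_const {A : Type*} [TopologicalSpace A] [PreconnectedSpace A] {k : A → ℂ}
    (hk : Continuous k) (hexp : ∀ a b, Complex.exp (k a) = Complex.exp (k b)) (a b : A) :
    k a = k b :=
  Complex.isCoveringMap_exp.const_of_comp hk (fun a b ↦ Subtype.ext (hexp a b)) a b

theorem exists_continuous_log {A : Type*} [TopologicalSpace A] [SimplyConnectedSpace A]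
    [LocallyPathConnectedSpace A] {f : A → ℂ} (hf : Continuous f) (h0 : ∀ a, f a ≠ 0) :
    ∃ g : A → ℂ, Continuous g ∧ ∀ a, Complex.exp (g a) = f a := by
  obtain ⟨a₀⟩ : Nonempty A := inferInstance
  obtain ⟨g, ⟨-, hg⟩, -⟩ := Complex.isCoveringMapOn_exp.existsUnique_continuousMap_lifts
    ⟨f, hf⟩ (Complex.exp_log (h0 a₀)) h0
  exact ⟨g, g.continuous, congrFun hg⟩

/-- The point of the unit sphere with polar angle `φ` and azimuth `θ`. -/
def sphericalPoint (φ θ : ℝ) : Sph :=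
  ⟨!₂[Real.sin φ * Real.cos θ, Real.sin φ * Real.sin θ, Real.cos φ], by
    rw [mem_sphere_zero_iff_norm, EuclideanSpace.norm_eq, Real.sqrt_eq_one, Fin.sum_univ_three]
    simp only [Real.norm_eq_abs, sq_abs, Matrix.cons_val]
    linear_combination Real.sin φ ^ 2 * Real.sin_sq_add_cos_sq θ + Real.sin_sq_add_cos_sq φ⟩

/-- The hairy ball theorem for the 2-sphere. -/
theorem not_admitsTangentField_id : ¬ AdmitsTangentField (id : Sph → Sph) := by
  rintro ⟨v, hv, hvid⟩
  have hp : Continuous fun z : ℝ × ℝ ↦ sphericalPoint z.1 z.2 := by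
    unfold sphericalPoint
    fun_prop
  let u : ℝ → ℝ → EuclideanSpace ℝ (Fin 3) := fun φ θ ↦ v (sphericalPoint φ θ)
  have hu : Continuous fun z : ℝ × ℝ ↦ u z.1 z.2 := hv.comp hp
  have horth (φ θ : ℝ) : u φ θ 0 * (Real.sin φ * Real.cos θ) + u φ θ 1 * (Real.sin φ * Real.sin θ)
      + u φ θ 2 * Real.cos φ = 0 := by
    have := (hvid (sphericalPoint φ θ)).2
    simp only [id, PiLp.inner_apply, Fin.sum_univ_three, sphericalPoint] at this
    simp [u, sphericalPoint] at this ⊢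
    linear_combination this
  let a : ℝ → ℝ → ℝ := fun φ θ ↦ u φ θ 0 * (Real.cos φ * Real.cos θ)
    + u φ θ 1 * (Real.cos φ * Real.sin θ) - u φ θ 2 * Real.sin φ
  let b : ℝ → ℝ → ℝ := fun φ θ ↦ u φ θ 1 * Real.cos θ - u φ θ 0 * Real.sin θ
  let f : ℝ × ℝ → ℂ := fun z ↦ a z.1 z.2 + b z.1 z.2 * Complex.I
  have hf : Continuous f := by
    fun_prop
  have hf0 (z : ℝ × ℝ) : f z ≠ 0 := by
    obtain ⟨φ, θ⟩ := z
    intro h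
    have ha : a φ θ = 0 := by simpa [f] using congrArg Complex.re h
    have hb : b φ θ = 0 := by simpa [f] using congrArg Complex.im h
    have hφ := Real.sin_sq_add_cos_sq φ
    have hθ := Real.sin_sq_add_cos_sq θ
    have ho := horth φ θ
    refine (hvid (sphericalPoint φ θ)).1 ?_
    change u φ θ = 0
    simp only [a, b] at ha hb
    have hρ : u φ θ 0 * Real.cos θ + u φ θ 1 * Real.sin θ = 0 := by
      linear_combination Real.sin φ * ho + Real.cos φ * ha
        - (u φ θ 0 * Real.cos θ + u φ θ 1 * Real.sin θ) * hφ
    ext i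
    fin_cases i
    · change u φ θ 0 = 0
      linear_combination Real.cos θ * hρ - Real.sin θ * hb - u φ θ 0 * hθ
    · change u φ θ 1 = 0
      linear_combination Real.sin θ * hρ + Real.cos θ * hb - u φ θ 1 * hθ
    · change u φ θ 2 = 0
      linear_combination Real.cos φ * ho - Real.sin φ * ha - u φ θ 2 * hφ
  obtain ⟨g, hg, hgf⟩ := exists_continuous_log hf hf0
  have hperiod (φ : ℝ) : f (φ, 2 * Real.pi) = f (φ, 0) := by
    simp [f, a, b, u, sphericalPoint]
  have hconst : g (0, 2 * Real.pi) - g (0, 0) = g (Real.pi, 2 * Real.pi) - g (Real.pi, 0) := by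
    refine eq_of_exp_comp_const (k := fun φ ↦ g (φ, 2 * Real.pi) - g (φ, 0)) (by fun_prop)
      (fun φ ψ ↦ ?_) 0 Real.pi
    simp [Complex.exp_sub, hgf, hperiod, hf0]
  have hzero (θ : ℝ) : f (0, θ) * Complex.exp (θ * Complex.I) = f (0, 0) := by
    have hu0 : u 0 θ = u 0 0 := by simp [u, sphericalPoint]
    simp only [f, a, b, hu0, Complex.exp_mul_I]
    simp
    linear_combination (u 0 0 0 + u 0 0 1 * Complex.I : ℂ) * Complex.sin_sq_add_cos_sq (θ : ℂ)
      + (u 0 0 1 * Complex.cos θ - u 0 0 0 * Complex.sin θ) * Complex.sin θ * Complex.I_sq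
  have hpi (θ : ℝ) : f (Real.pi, θ) * Complex.exp (-(θ * Complex.I)) = f (Real.pi, 0) := by
    have hu0 : u Real.pi θ = u Real.pi 0 := by simp [u, sphericalPoint]
    rw [← neg_mul]
    simp only [f, a, b, hu0, Complex.exp_mul_I]
    simp
    linear_combination (-u Real.pi 0 0 + u Real.pi 0 1 * Complex.I : ℂ) *
      Complex.sin_sq_add_cos_sq (θ : ℂ) - (u Real.pi 0 1 * Complex.cos θ
        - u Real.pi 0 0 * Complex.sin θ) * Complex.sin θ * Complex.I_sq
  have hzero' : g (0, 2 * Real.pi) + (2 * Real.pi : ℝ) * Complex.I = g (0, 0) := by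
    have := eq_of_exp_comp_const (k := fun θ : ℝ ↦ g (0, θ) + θ * Complex.I) (by fun_prop)
      (fun θ η ↦ by rw [Complex.exp_add, Complex.exp_add, hgf, hgf, hzero, hzero])
      (2 * Real.pi) 0
    simpa using this
  have hpi' : g (Real.pi, 2 * Real.pi) + -((2 * Real.pi : ℝ) * Complex.I) = g (Real.pi, 0) := by
    have := eq_of_exp_comp_const (k := fun θ : ℝ ↦ g (Real.pi, θ) + -(θ * Complex.I))
      (by fun_prop)
      (fun θ η ↦ by rw [Complex.exp_add, Complex.exp_add, hgf, hgf, hpi, hpi])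
      (2 * Real.pi) 0
    simpa using this
  have : (4 * Real.pi : ℂ) * Complex.I = 0 := by
    push_cast at hzero' hpi'
    linear_combination hzero' - hpi' - hconst
  simp [Real.pi_ne_zero] at this

/-- The two coordinate projections `S² × S² → S²` are not homotopic. -/
theorem not_homotopic_fst_snd :
    ¬ (ContinuousMap.fst : C(Xt, Sph)).Homotopic ContinuousMap.snd := by
  intro h
  let p : Sph := sphericalPoint 0 0
  have hconst : AdmitsTangentField (ContinuousMap.const Sph p) := by
    refine ⟨fun _ ↦ EuclideanSpace.single 0 1, by fun_prop, fun _ ↦ ⟨by simp, ?_⟩⟩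
    simp [p, sphericalPoint, EuclideanSpace.inner_single_left]
  have h' := h.comp (.refl ((ContinuousMap.id Sph).prodMk (ContinuousMap.const Sph p)))
  exact not_admitsTangentField_id (hconst.of_homotopic h'.symm)

/-- No two distinct maps among `I`, `T`, `P'`, `P''` (each of which fixes the
diagonal) are homotopic rel the diagonal `D`. -/
theorem canonical_self_maps_pairwise_non_homotopic :
    ∀ f ∈ ({Imap, Tmap, P1map, P2map} : Set C(Xt, Xt)),
      ∀ g ∈ ({Imap, Tmap, P1map, P2map} : Set C(Xt, Xt)),
        f ≠ g → ¬ Nonempty (f.HomotopyRel g Ddiag) := by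
  have key {f g : C(Xt, Xt)} (h : Nonempty (f.HomotopyRel g Ddiag)) (c : C(Xt, Sph)) :
      (c.comp f).Homotopic (c.comp g) :=
    (ContinuousMap.Homotopic.refl c).comp (ContinuousMap.HomotopicRel.homotopic h)
  rintro f (rfl | rfl | rfl | rfl) g (rfl | rfl | rfl | rfl) hne h
  · exact hne rfl
  · exact not_homotopic_fst_snd (key h .fst)
  · exact not_homotopic_fst_snd (key h .snd).symm
  · exact not_homotopic_fst_snd (key h .fst)
  · exact not_homotopic_fst_snd (key h .fst).symm
  · exact hne rfl
  · exact not_homotopic_fst_snd (key h .fst).symm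
  · exact not_homotopic_fst_snd (key h .snd)
  · exact not_homotopic_fst_snd (key h .snd)
  · exact not_homotopic_fst_snd (key h .fst)
  · exact hne rfl
  · exact not_homotopic_fst_snd (key h .fst)
  · exact not_homotopic_fst_snd (key h .fst).symm
  · exact not_homotopic_fst_snd (key h .snd).symm
  · exact not_homotopic_fst_snd (key h .fst).symm
  · exact hne rfl
end
end

section
/- Let d : M₂ →* M₁ be a pre-crossed module. Then the Peiffer subgroup P, i.e. the subgroup of M₂ generated by all Peiffer commutators ⟨x,y⟩ = x⁻¹ · y⁻¹ · x · (y • d(x)) for x, y ∈ M₂, is a normal subgroup of M₂ which is stable under the action of M₁, and the induced homomorphism d̄ : M₂⧸P →* M₁ together with the induced M₁-action on M₂⧸P is a crossed module: d̄(x̄ • m) = m⁻¹ · d̄(x̄) · m for all m ∈ M₁ and x̄ ∈ M₂⧸P, and ȳ • d̄(x̄) = x̄⁻¹ · ȳ · x̄ for all x̄, ȳ ∈ M₂⧸P. -/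
/-- A closure is normal as soon as all conjugates of its generators lie in it. -/
theorem Subgroup.closure_normal_of_conj_mem {G : Type*} [Group G] {S : Set G}
    (h : ∀ z ∈ S, ∀ g : G, g * z * g⁻¹ ∈ Subgroup.closure S) : (Subgroup.closure S).Normal := by
  refine ⟨fun z hz g => ?_⟩
  have hle : Subgroup.closure S ≤ (Subgroup.closure S).comap (MulAut.conj g).toMonoidHom :=
    (Subgroup.closure_le _).2 fun z hz => by simpa using h z hz g
  simpa using hle hz

/-- Given a pre-crossed module `d : M₂ →* M₁` (a right action of `M₁` on `M₂`
by group automorphisms together with an equivariant homomorphism `d`), the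
Peiffer subgroup `P` generated by all Peiffer commutators
`⟨x,y⟩ = x⁻¹ * y⁻¹ * x * (y • d x)` is a normal subgroup of `M₂`, stable under
the action of `M₁`, and the induced homomorphism `M₂ ⧸ P →* M₁` with the
induced `M₁`-action is a crossed module. -/
theorem peiffer_quotient_is_crossed_module
    {M₁ M₂ : Type*} [Group M₁] [Group M₂]
    (smul : M₂ → M₁ → M₂)
    (smul_mul : ∀ (x : M₂) (m m' : M₁), smul x (m * m') = smul (smul x m) m')
    (smul_one : ∀ x : M₂, smul x 1 = x)
    (mul_smul : ∀ (x y : M₂) (m : M₁), smul (x * y) m = smul x m * smul y m)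
    (d : M₂ →* M₁)
    (hd : ∀ (x : M₂) (m : M₁), d (smul x m) = m⁻¹ * d x * m) :
    let P : Subgroup M₂ :=
      Subgroup.closure {z : M₂ | ∃ x y : M₂, z = x⁻¹ * y⁻¹ * x * smul y (d x)}
    ∃ hN : P.Normal,
      (∀ z ∈ P, ∀ m : M₁, smul z m ∈ P) ∧
      (haveI := hN
       ∃ (dbar : M₂ ⧸ P →* M₁) (sbar : M₂ ⧸ P → M₁ → M₂ ⧸ P),
        (∀ x : M₂, dbar ((x : M₂ ⧸ P)) = d x) ∧
        (∀ (x : M₂) (m : M₁), sbar ((x : M₂ ⧸ P)) m = ((smul x m : M₂) : M₂ ⧸ P)) ∧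
        (∀ (xb : M₂ ⧸ P) (m m' : M₁), sbar xb (m * m') = sbar (sbar xb m) m') ∧
        (∀ xb : M₂ ⧸ P, sbar xb 1 = xb) ∧
        (∀ (xb yb : M₂ ⧸ P) (m : M₁), sbar (xb * yb) m = sbar xb m * sbar yb m) ∧
        (∀ (xb : M₂ ⧸ P) (m : M₁), dbar (sbar xb m) = m⁻¹ * dbar xb * m) ∧
        (∀ xb yb : M₂ ⧸ P, sbar yb (dbar xb) = xb⁻¹ * yb * xb)) := by
  intro P
  have peiffer_mem : ∀ x y : M₂, x⁻¹ * y⁻¹ * x * smul y (d x) ∈ P :=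
    fun x y => Subgroup.subset_closure ⟨x, y, rfl⟩
  let act (m : M₁) : M₂ →* M₂ := MonoidHom.mk' (smul · m) fun x y => mul_smul x y m
  have act_inv (x : M₂) (m : M₁) : smul x⁻¹ m = (smul x m)⁻¹ := map_inv (act m) x
  have hN : P.Normal := by
    refine Subgroup.closure_normal_of_conj_mem ?_
    rintro _ ⟨x, y, rfl⟩ g
    have h := P.mul_mem (peiffer_mem x (y * (x * g⁻¹ * x⁻¹)))
      (P.inv_mem (peiffer_mem x (x * g⁻¹ * x⁻¹)))
    rw [mul_smul y] at h
    convert h using 1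
    group
  have hstable (m : M₁) : P ≤ P.comap (act m) := by
    refine (Subgroup.closure_le _).2 ?_
    rintro _ ⟨x, y, rfl⟩
    change smul _ m ∈ P
    have h := peiffer_mem (smul x m) (smul y m)
    rwa [hd, ← smul_mul, ← mul_assoc, mul_inv_cancel_left, smul_mul, ← act_inv, ← act_inv,
      ← mul_smul, ← mul_smul, ← mul_smul] at h
  have hker : P ≤ d.ker := by
    refine (Subgroup.closure_le _).2 ?_
    rintro _ ⟨x, y, rfl⟩
    simp only [SetLike.mem_coe, MonoidHom.mem_ker, map_mul, map_inv, hd]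
    group
  refine ⟨hN, fun z hz m => hstable m hz, QuotientGroup.lift P d hker,
    fun xb m => QuotientGroup.map P P (act m) (hstable m) xb, fun _ => rfl, fun _ _ => rfl,
    ?_, ?_, fun xb yb m => map_mul _ xb yb, ?_, ?_⟩
  · rintro ⟨x⟩ m m'
    exact congrArg _ (smul_mul x m m')
  · rintro ⟨x⟩
    exact congrArg _ (smul_one x)
  · rintro ⟨x⟩ m
    exact hd x m
  · rintro ⟨x⟩ ⟨y⟩
    refine (QuotientGroup.eq (s := P) (a := x⁻¹ * y * x) (b := smul y (d x))).2 ?_ |>.symm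
    convert peiffer_mem x y using 1
    group
end

section
/- Let d : M₂ →* M₁ be a nil(2)-module, i.e. a pre-crossed module in which all iterated Peiffer commutators of length ≥ 3 vanish: ⟨⟨x,y⟩,z⟩ = 1 and ⟨x,⟨y,z⟩⟩ = 1 for all x, y, z ∈ M₂. Then the Peiffer commutator map is bilinear and equivariant: ⟨x·x', y⟩ = ⟨x,y⟩ · ⟨x',y⟩ and ⟨x, y·y'⟩ = ⟨x,y⟩ · ⟨x,y'⟩ for all x, x', y, y' ∈ M₂, ⟨x,y⟩ • m = ⟨x • m, y • m⟩ for all m ∈ M₁, and ⟨x,y⟩ depends only on the images of x and y in the abelianization of M₂⧸P, where P is the Peiffer subgroup: if x⁻¹·x' lies in the subgroup generated by P together with the commutator subgroup of M₂, then ⟨x,y⟩ = ⟨x',y⟩ and ⟨y,x⟩ = ⟨y,x'⟩. -/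
/-- The Peiffer commutator `⟨x,y⟩ = x⁻¹ * y⁻¹ * x * (y • d x)` of a
pre-crossed module. -/
def peiffer {M₁ M₂ : Type*} [Group M₁] [Group M₂]
    (smul : M₂ → M₁ → M₂) (d : M₂ →* M₁) (x y : M₂) : M₂ :=
  x⁻¹ * y⁻¹ * x * smul y (d x)

/-- The Peiffer subgroup, generated by all Peiffer commutators. -/
def peifferSubgroup {M₁ M₂ : Type*} [Group M₁] [Group M₂]
    (smul : M₂ → M₁ → M₂) (d : M₂ →* M₁) : Subgroup M₂ :=
  Subgroup.closure {z : M₂ | ∃ x y : M₂, z = peiffer smul d x y}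

theorem MonoidHom.commutator_le_ker_of_commute {G H : Type*} [Group G] [Group H] (f : G →* H)
    (hf : ∀ x y, Commute (f x) (f y)) : commutator G ≤ f.ker := by
  rw [commutator_def, Subgroup.commutator_le]
  intro x _ y _
  rw [MonoidHom.mem_ker, map_commutatorElement, commutatorElement_eq_one_iff_commute]
  exact hf x y

/-- A homomorphism with commuting values that kills all Peiffer commutators identifies elements
which agree modulo the Peiffer subgroup and the commutator subgroup. -/
theorem eq_of_mem_peifferSubgroup_sup_commutator {M₁ M₂ H : Type*}
    [Group M₁] [Group M₂] [Group H] {smul : M₂ → M₁ → M₂} {d : M₂ →* M₁} (f : M₂ →* H)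
    (hf : ∀ x y, Commute (f x) (f y)) (hP : ∀ x y, f (peiffer smul d x y) = 1) {x x' : M₂}
    (h : x⁻¹ * x' ∈ peifferSubgroup smul d ⊔ commutator M₂) : f x = f x' := by
  have hle : peifferSubgroup smul d ⊔ commutator M₂ ≤ f.ker := by
    refine sup_le ((Subgroup.closure_le _).2 ?_) (f.commutator_le_ker_of_commute hf)
    rintro _ ⟨x, y, rfl⟩
    exact hP x y
  have hker := hle h
  rwa [MonoidHom.mem_ker, map_mul, map_inv, inv_mul_eq_one] at hker

/-- In a nil(2)-module (a pre-crossed module in which all iterated Peiffer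
commutators of length ≥ 3 vanish) the Peiffer commutator map is bilinear and
equivariant, and depends only on the images of its arguments in the
abelianization of `M₂` modulo the Peiffer subgroup. -/
theorem peiffer_commutator_map_of_nil2
    {M₁ M₂ : Type*} [Group M₁] [Group M₂]
    (smul : M₂ → M₁ → M₂)
    (smul_mul : ∀ (x : M₂) (m m' : M₁), smul x (m * m') = smul (smul x m) m')
    (smul_one : ∀ x : M₂, smul x 1 = x)
    (mul_smul : ∀ (x y : M₂) (m : M₁), smul (x * y) m = smul x m * smul y m)
    (d : M₂ →* M₁)
    (hd : ∀ (x : M₂) (m : M₁), d (smul x m) = m⁻¹ * d x * m)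
    (nil2_left : ∀ x y z : M₂, peiffer smul d (peiffer smul d x y) z = 1)
    (nil2_right : ∀ x y z : M₂, peiffer smul d x (peiffer smul d y z) = 1) :
    (∀ x x' y : M₂,
        peiffer smul d (x * x') y = peiffer smul d x y * peiffer smul d x' y) ∧
    (∀ x y y' : M₂,
        peiffer smul d x (y * y') = peiffer smul d x y * peiffer smul d x y') ∧
    (∀ (x y : M₂) (m : M₁),
        smul (peiffer smul d x y) m = peiffer smul d (smul x m) (smul y m)) ∧
    (∀ x x' y : M₂,
        x⁻¹ * x' ∈ peifferSubgroup smul d ⊔ commutator M₂ →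
        peiffer smul d x y = peiffer smul d x' y ∧
        peiffer smul d y x = peiffer smul d y x') := by
  have smul_eq (x y : M₂) : smul y (d x) = x⁻¹ * y * x * peiffer smul d x y := by
    simp only [peiffer]; group
  have smul_inv (x : M₂) (m : M₁) : smul x⁻¹ m = (smul x m)⁻¹ :=
    map_inv (MonoidHom.mk' (smul · m) (mul_smul · · m)) x
  have d_peiffer (x y : M₂) : d (peiffer smul d x y) = 1 := by
    simp only [peiffer, map_mul, map_inv, hd]; group
  have central (x y z : M₂) : Commute (peiffer smul d x y) z := by
    have h := smul_eq (peiffer smul d x y) z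
    rw [d_peiffer, smul_one, nil2_left, mul_one, mul_assoc, eq_inv_mul_iff_mul_eq] at h
    exact h
  have fixed (x y z : M₂) : smul (peiffer smul d x y) (d z) = peiffer smul d x y := by
    rw [smul_eq, nil2_right, mul_one, mul_assoc, (central x y z).eq, inv_mul_cancel_left]
  have mul_right (x y y' : M₂) :
      peiffer smul d x (y * y') = peiffer smul d x y * peiffer smul d x y' := by
    have h : peiffer smul d x (y * y') = x⁻¹ * y'⁻¹ * x *
        (peiffer smul d x y * (x⁻¹ * y' * x)) * peiffer smul d x y' := by
      simp only [peiffer, mul_smul]; group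
    rw [h, (central x y _).eq]
    group
  have conj_right (x y z : M₂) : peiffer smul d x (z⁻¹ * y * z) = peiffer smul d x y := by
    let f := MonoidHom.mk' (peiffer smul d x) (mul_right x)
    change f (z⁻¹ * y * z) = f y
    have h : Commute (f y) (f z) := central x y _
    rw [map_mul, map_mul, map_inv, mul_assoc, h.eq, inv_mul_cancel_left]
  have mul_left (x x' y : M₂) :
      peiffer smul d (x * x') y = peiffer smul d x y * peiffer smul d x' y := by
    have h : smul y (d (x * x')) = x'⁻¹ * (x⁻¹ * y * x) * x' *
        (peiffer smul d x' y * peiffer smul d x y) := by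
      rw [map_mul, smul_mul, smul_eq x y, mul_smul, fixed, smul_eq, conj_right, mul_assoc]
    rw [← (central x' y _).eq]
    conv_lhs => rw [peiffer, h]
    group
  refine ⟨mul_left, mul_right, fun x y m => ?_, fun x x' y h => ⟨?_, ?_⟩⟩
  · simp only [peiffer, mul_smul, smul_inv, hd, ← smul_mul]
    simp only [mul_assoc, mul_inv_cancel_left]
  · exact eq_of_mem_peifferSubgroup_sup_commutator
        (MonoidHom.mk' (peiffer smul d · y) (mul_left · · y)) (fun x z => central x y _)
        (fun x z => nil2_left x z y) h
  · exact eq_of_mem_peifferSubgroup_sup_commutator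
        (MonoidHom.mk' (peiffer smul d y) (mul_right y)) (fun x z => central y x _)
        (fun x z => nil2_right y x z) h
end
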